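/- Let H be a finitely generated free abelian group and T : H → H a group endomorphism. Let T_ℚ be the induced endomorphism of H ⊗_ℤ ℚ and T_{ℚ/ℤ} the induced endomorphism of H ⊗_ℤ (ℚ/ℤ), and let π : H ⊗_ℤ ℚ → H ⊗_ℤ (ℚ/ℤ) be the map induced by the quotient ℚ → ℚ/ℤ. Then π maps Ker(T_ℚ − id) into Ker(T_{ℚ/ℤ} − id), and the quotient Ker(T_{ℚ/ℤ} − id) / π(Ker(T_ℚ − id)) is isomorphic (as an abelian group) to the torsion subgroup of the cokernel H / Im(T − id). -/

import Mathlib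

open TensorProduct

/-- The kernel of the canonical map `M → ℚ ⊗_ℤ M` is the torsion of `M`. -/
theorem rat_one_tmul_eq_zero_iff {M : Type*} [AddCommGroup M] (x : M) :
    (1 : ℚ) ⊗ₜ[ℤ] x = 0 ↔ IsOfFinAddOrder x := by
  have := IsLocalizedModule.eq_zero_iff (nonZeroDivisors ℤ) (TensorProduct.mk ℤ ℚ M 1) (m := x)
  rw [TensorProduct.mk_apply] at this
  rw [this, isOfFinAddOrder_iff_zsmul_eq_zero]
  constructor
  · rintro ⟨c, hc⟩
    exact ⟨c, nonZeroDivisors.coe_ne_zero c, hc⟩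
  · rintro ⟨n, hn, h⟩
    exact ⟨⟨n, mem_nonZeroDivisors_of_ne_zero hn⟩, h⟩

/-- The sequence `M → ℚ ⊗_ℤ M → (ℚ/ℤ) ⊗_ℤ M` is exact. -/
theorem exact_rat_mk_rTensor_mkQ (M : Type*) [AddCommGroup M] :
    Function.Exact (TensorProduct.mk ℤ ℚ M 1)
      (LinearMap.rTensor M (Submodule.span ℤ {(1 : ℚ)}).mkQ) := by
  have hex : Function.Exact (LinearMap.toSpanSingleton ℤ ℚ 1)
      (Submodule.span ℤ {(1 : ℚ)}).mkQ := by
    rw [LinearMap.exact_iff, Submodule.ker_mkQ, LinearMap.range_toSpanSingleton]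
  have hmk : TensorProduct.mk ℤ ℚ M 1 = (LinearMap.toSpanSingleton ℤ ℚ 1).rTensor M ∘ₗ
      (TensorProduct.lid ℤ M).symm.toLinearMap := by
    ext x
    simp
  rw [LinearMap.exact_iff, hmk, LinearMap.range_comp_of_range_eq_top _ (LinearEquiv.range _)]
  exact (rTensor_exact M hex (Submodule.mkQ_surjective _)).linearMap_ker_eq

/-- Let `H` be a finitely generated free abelian group and `T : H → H`
a group endomorphism.  Realize `ℚ/ℤ` as `ℚ ⧸ span ℤ {1}`.  Let `Tq` (resp. `Tqz`) be
the endomorphism of `ℚ ⊗_ℤ H` (resp. `(ℚ/ℤ) ⊗_ℤ H`) induced by `T`, and let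
`π : ℚ ⊗_ℤ H → (ℚ/ℤ) ⊗_ℤ H` be induced by the quotient map `ℚ → ℚ/ℤ`.  Then `π`
maps `Ker (Tq - id)` into `Ker (Tqz - id)`, and
`Ker (Tqz - id) ⧸ π (Ker (Tq - id))` is isomorphic as an abelian group to the
torsion subgroup of `H ⧸ Im (T - id)`. -/
theorem stmt_1 (H : Type*) [AddCommGroup H] [Module.Free ℤ H] [Module.Finite ℤ H]
    (T : H →+ H)
    (f : H →ₗ[ℤ] H) (hf : f = T.toIntLinearMap - LinearMap.id)
    (Tq : ℚ ⊗[ℤ] H →ₗ[ℚ] ℚ ⊗[ℤ] H) (hTq : Tq = T.toIntLinearMap.baseChange ℚ)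
    (fq : ℚ ⊗[ℤ] H →ₗ[ℚ] ℚ ⊗[ℤ] H) (hfq : fq = Tq - LinearMap.id)
    (Tqz : (ℚ ⧸ Submodule.span ℤ {(1 : ℚ)}) ⊗[ℤ] H →ₗ[ℤ]
           (ℚ ⧸ Submodule.span ℤ {(1 : ℚ)}) ⊗[ℤ] H)
    (hTqz : Tqz = LinearMap.lTensor (ℚ ⧸ Submodule.span ℤ {(1 : ℚ)}) T.toIntLinearMap)
    (fqz : (ℚ ⧸ Submodule.span ℤ {(1 : ℚ)}) ⊗[ℤ] H →ₗ[ℤ]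
           (ℚ ⧸ Submodule.span ℤ {(1 : ℚ)}) ⊗[ℤ] H)
    (hfqz : fqz = Tqz - LinearMap.id)
    (π : ℚ ⊗[ℤ] H →ₗ[ℤ] (ℚ ⧸ Submodule.span ℤ {(1 : ℚ)}) ⊗[ℤ] H)
    (hπ : π = LinearMap.rTensor H (Submodule.span ℤ {(1 : ℚ)}).mkQ) :
    Submodule.map π ((LinearMap.ker fq).restrictScalars ℤ) ≤ LinearMap.ker fqz ∧
    Nonempty (((LinearMap.ker fqz) ⧸ Submodule.comap (LinearMap.ker fqz).subtype
        (Submodule.map π ((LinearMap.ker fq).restrictScalars ℤ))) ≃+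
      AddCommGroup.torsion (H ⧸ LinearMap.range f)) := by
  subst hπ
  have hfq' : fq.restrictScalars ℤ = f.lTensor ℚ := by
    subst hfq hTq hf
    rw [LinearMap.lTensor_sub, LinearMap.lTensor_id]
    rfl
  have hfqz' : fqz = f.lTensor _ := by
    rw [hfqz, hTqz, hf, LinearMap.lTensor_sub, LinearMap.lTensor_id]
    rfl
  set π := LinearMap.rTensor H (Submodule.span ℤ {(1 : ℚ)}).mkQ
  have comm₁ : (TensorProduct.mk ℤ ℚ H 1).comp f =
      (fq.restrictScalars ℤ).comp (TensorProduct.mk ℤ ℚ H 1) := by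
    rw [hfq']
    rfl
  have comm₂ : π.comp (fq.restrictScalars ℤ) = fqz.comp π := by
    rw [hfq', hfqz']
    exact (LinearMap.rTensor_comp_lTensor _ _ _).trans
      (LinearMap.lTensor_comp_rTensor _ _ _).symm
  have hle : Submodule.map π ((LinearMap.ker fq).restrictScalars ℤ) ≤ LinearMap.ker fqz := by
    rintro _ ⟨x, hx, rfl⟩
    have hx' : fq.restrictScalars ℤ x = 0 := hx
    exact (LinearMap.congr_fun comm₂ x).symm.trans ((congrArg π hx').trans (map_zero π))
  refine ⟨hle, ?_⟩
  have hπ : Function.Surjective π := LinearMap.rTensor_surjective H (Submodule.mkQ_surjective _)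
  have hinj : Function.Injective (TensorProduct.mk ℤ ℚ H 1) := by
    rw [injective_iff_map_eq_zero]
    intro x hx
    rw [TensorProduct.mk_apply, rat_one_tmul_eq_zero_iff, isOfFinAddOrder_iff_zsmul_eq_zero] at hx
    obtain ⟨n, hn, h⟩ := hx
    exact (smul_eq_zero.mp h).resolve_left hn
  have hex := exact_rat_mk_rTensor_mkQ H
  have hι₂ : Function.Exact ((LinearMap.ker fq).restrictScalars ℤ).subtype
      (fq.restrictScalars ℤ) := by
    rw [LinearMap.exact_iff, Submodule.range_subtype]
    rfl
  have hι₃ : Function.Exact (LinearMap.ker fqz).subtype fqz := LinearMap.exact_subtype_ker_map fqz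
  have hπ₁ : Function.Exact f (LinearMap.range f).mkQ := LinearMap.exact_map_mkQ_range f
  have hπ₂ : Function.Exact (fq.restrictScalars ℤ) ((LinearMap.range f).mkQ.lTensor ℚ) := by
    rw [hfq']
    exact lTensor_exact ℚ hπ₁ (Submodule.mkQ_surjective _)
  let δ := SnakeLemma.δ' f (fq.restrictScalars ℤ) fqz _ π hex _ π hex comm₁ comm₂
    _ hι₃ _ hπ₁ hπ hinj
  let F : (LinearMap.ker fq).restrictScalars ℤ →ₗ[ℤ] LinearMap.ker fqz :=
    π.restrict fun x hx ↦ hle (Submodule.mem_map_of_mem hx)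
  have hker : Function.Exact F δ :=
    SnakeLemma.exact_δ'_right f (fq.restrictScalars ℤ) fqz _ π hex _ π hex comm₁ comm₂
      _ hι₂ _ hι₃ _ hπ₁ hπ hinj F rfl (Submodule.subtype_injective _)
  have hrange : Function.Exact δ (TensorProduct.mk ℤ ℚ (H ⧸ LinearMap.range f) 1) :=
    SnakeLemma.exact_δ'_left f (fq.restrictScalars ℤ) fqz _ π hex _ π hex comm₁ comm₂
      _ hι₃ _ hπ₁ _ hπ₂ hπ hinj _ rfl (Submodule.mkQ_surjective _)
  have hkerδ : Submodule.comap (LinearMap.ker fqz).subtype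
      (Submodule.map π ((LinearMap.ker fq).restrictScalars ℤ)) = LinearMap.ker δ := by
    rw [hker.linearMap_ker_eq]
    ext x
    constructor
    · rintro ⟨y, hy, hyx⟩
      exact ⟨⟨y, hy⟩, Subtype.ext hyx⟩
    · rintro ⟨y, rfl⟩
      exact ⟨y, y.2, rfl⟩
  have hrangeδ : (LinearMap.range δ).toAddSubgroup =
      AddCommGroup.torsion (H ⧸ LinearMap.range f) := by
    ext x
    rw [AddCommGroup.mem_torsion, ← rat_one_tmul_eq_zero_iff]
    exact (hrange x).symm
  exact ⟨((Submodule.quotEquivOfEq _ _ hkerδ).trans δ.quotKerEquivRange).toAddEquiv.trans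
    (AddEquiv.addSubgroupCongr hrangeδ)⟩
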